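/- Let θ be a theta function for q (a nonzero holomorphic function θ : ℂ^g → ℂ with θ(z + γ) = e_γ(z)·θ(z) for all γ ∈ Γ, z ∈ ℂ^g). Then for all z ∈ ℂ^g one has θ(i·z) = (1 − i)^{−g} · (∑_{α ∈ A_i} i^{Q_q(α)}) · θ(z), where i^{c} for c ∈ ℤ/4ℤ denotes i^n for any representative n ∈ ℤ of c. -/

import Mathlib

/-- The embedding `F₂ ≅ 2ℤ/4ℤ ⊂ ℤ/4ℤ`. -/
def emb2 (t : ZMod 2) : ZMod 4 := 2 * t.val

/-- `i^c ∈ ℂ` for `c ∈ ℤ/4ℤ` (equal to `i^n` for any representative `n` of `c`). -/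
noncomputable def iPow (c : ZMod 4) : ℂ := Complex.I ^ c.val

/-- The standard Hermitian inner product `H(x, y) = ∑_j conj(x_j)·y_j` on `ℂ^g`. -/
noncomputable def Hform (g : ℕ) (x y : Fin g → ℂ) : ℂ :=
  ∑ j, (starRingEnd ℂ) (x j) * y j

/-- `ε := id + ī`, an `F₂`-linear endomorphism of `A₂`. -/
def eps {A : Type*} [AddCommGroup A] [Module (ZMod 2) A]
    (Ibar : A →ₗ[ZMod 2] A) : A →ₗ[ZMod 2] A :=
  LinearMap.id + Ibar

/-- `A_i := ε(A₂)`. -/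
def Asub {A : Type*} [AddCommGroup A] [Module (ZMod 2) A]
    (Ibar : A →ₗ[ZMod 2] A) : Submodule (ZMod 2) A :=
  LinearMap.range (eps Ibar)


section ThetaAux
open MeasureTheory Set Filter Topology

lemma Hf_add_left {g : ℕ} (x y z : Fin g → ℂ) : Hform g (x + y) z = Hform g x z + Hform g y z := by
  simp [Hform, add_mul, Finset.sum_add_distrib]

lemma Hf_add_right {g : ℕ} (x y z : Fin g → ℂ) : Hform g x (y + z) = Hform g x y + Hform g x z := by
  simp [Hform, mul_add, Finset.sum_add_distrib]

lemma Hf_smul_left {g : ℕ} (c : ℂ) (x y : Fin g → ℂ) :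
    Hform g (c • x) y = (starRingEnd ℂ) c * Hform g x y := by
  simp [Hform, Finset.mul_sum, mul_assoc]

lemma Hf_smul_right {g : ℕ} (c : ℂ) (x y : Fin g → ℂ) :
    Hform g x (c • y) = c * Hform g x y := by
  simp only [Hform, Finset.mul_sum, Pi.smul_apply, smul_eq_mul]
  exact Finset.sum_congr rfl fun _ _ => by ring

lemma Hf_neg_left {g : ℕ} (x y : Fin g → ℂ) : Hform g (-x) y = - Hform g x y := by
  simp [Hform]

lemma Hf_neg_right {g : ℕ} (x y : Fin g → ℂ) : Hform g x (-y) = - Hform g x y := by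
  simp [Hform]

lemma Hf_sub_left {g : ℕ} (x y z : Fin g → ℂ) : Hform g (x - y) z = Hform g x z - Hform g y z := by
  rw [sub_eq_add_neg, Hf_add_left, Hf_neg_left, sub_eq_add_neg]

lemma Hf_sub_right {g : ℕ} (x y z : Fin g → ℂ) : Hform g x (y - z) = Hform g x y - Hform g x z := by
  rw [sub_eq_add_neg, Hf_add_right, Hf_neg_right, sub_eq_add_neg]

lemma Hf_conj {g : ℕ} (x y : Fin g → ℂ) : (starRingEnd ℂ) (Hform g x y) = Hform g y x := by
  simp only [Hform, map_sum, map_mul, Complex.conj_conj]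
  exact Finset.sum_congr rfl fun _ _ => by ring

lemma Hf_self {g : ℕ} (x : Fin g → ℂ) : Hform g x x = ((∑ j, ‖x j‖ ^ 2 : ℝ) : ℂ) := by
  simp only [Hform]
  push_cast
  exact Finset.sum_congr rfl fun _ _ => by rw [Complex.conj_mul']

lemma Hf_cont {g : ℕ} : Continuous (fun p : (Fin g → ℂ) × (Fin g → ℂ) => Hform g p.1 p.2) := by
  unfold Hform
  fun_prop

lemma Hf_cont' {g : ℕ} {X : Type*} [TopologicalSpace X] {u v : X → Fin g → ℂ}
    (hu : Continuous u) (hv : Continuous v) : Continuous (fun x => Hform g (u x) (v x)) :=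
  Hf_cont.comp (hu.prodMk hv)

lemma Hf_swap {g : ℕ} (x y : Fin g → ℂ) :
    Hform g x y - Hform g y x = 2 * Complex.I * ((Hform g x y).im : ℂ) := by
  rw [← Hf_conj x y, Complex.sub_conj]; push_cast; ring

/-- holomorphic dependence of an integral over a bounded set -/
lemma diff_int {g : ℕ} {F : Set (Fin g → ℂ)} (hFb : Bornology.IsBounded F)
    (K : ℂ → (Fin g → ℂ) → ℂ) (hK : Continuous (Function.uncurry K))
    (hd : ∀ z, Differentiable ℂ (fun t => K t z)) :
    Differentiable ℂ (fun t => ∫ z in F, K t z) := by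
  intro t₀
  have hFf : volume F < ⊤ := hFb.measure_lt_top
  have : IsFiniteMeasure (volume.restrict F) := ⟨by simpa using hFf⟩
  have hcF : IsCompact (closure F) := hFb.isCompact_closure
  have hcomp : IsCompact ((Metric.closedBall t₀ 2) ×ˢ closure F) :=
    (isCompact_closedBall _ _).prod hcF
  obtain ⟨C, hC⟩ := hcomp.exists_bound_of_continuousOn hK.continuousOn
  have hKt : ∀ t, Continuous (K t) := fun t => hK.comp (Continuous.prodMk_right t)
  have haeF : ∀ᵐ z ∂(volume.restrict F), z ∈ closure F := by
    have h1 : ∀ᵐ z ∂(volume.restrict (closure F)), z ∈ closure F :=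
      ae_restrict_mem isClosed_closure.measurableSet
    exact (Measure.absolutelyContinuous_of_le
      (Measure.restrict_mono subset_closure le_rfl)).ae_le h1
  have key := hasDerivAt_integral_of_dominated_loc_of_deriv_le (𝕜 := ℂ) (μ := volume.restrict F)
    (F := K) (F' := fun t z => deriv (fun s => K s z) t) (x₀ := t₀) (bound := fun _ => C)
    (s := Metric.ball t₀ 1) (Metric.ball_mem_nhds _ one_pos)
    (Eventually.of_forall fun t => (hKt t).aestronglyMeasurable)
    (Integrable.of_bound (hKt t₀).aestronglyMeasurable C (by
      filter_upwards [haeF] with z hz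
      exact hC (t₀, z) ⟨Metric.mem_closedBall_self (by norm_num), hz⟩))
    (by
      have := measurable_deriv_with_param (𝕜 := ℂ) (f := fun z t => K t z)
        (hK.comp continuous_swap)
      have h2 : Measurable (fun z => deriv (fun s => K s z) t₀) :=
        this.comp (measurable_id.prodMk measurable_const)
      exact h2.aestronglyMeasurable)
    (by
      filter_upwards [haeF] with z hz t ht
      have := Complex.norm_deriv_le_of_forall_mem_sphere_norm_le (c := t) (R := 1)
        (f := fun s => K s z) (C := C) one_pos ((hd z).diffContOnCl) (by
          intro s hs
          refine hC (s, z) ⟨?_, hz⟩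
          rw [Metric.mem_closedBall]
          have h1 := Metric.mem_sphere.1 hs
          have h2 := Metric.mem_ball.1 ht
          linarith [dist_triangle s t t₀])
      simpa using this)
    (integrable_const _)
    (by
      filter_upwards with z t ht
      exact (hd z t).hasDerivAt)
  exact key.2.differentiableAt

lemma const_of_conj {a : ℂ → ℂ} (ha : Differentiable ℂ a)
    (hb : Differentiable ℂ (fun t => (starRingEnd ℂ) (a t))) (s t : ℂ) : a s = a t := by
  refine is_const_of_deriv_eq_zero ha (fun x => ?_) s t
  have gen : ∀ φ : ℂ → ℂ, Differentiable ℂ φ → ∀ w : ℂ,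
      HasDerivAt (fun u : ℝ => φ (x + u * w)) (deriv φ x * w) 0 := by
    intro φ hφ w
    have h0 : HasDerivAt (fun u : ℝ => x + u * w) w 0 := by
      simpa using ((Complex.ofRealCLM.hasDerivAt (x := (0:ℝ))).mul_const w).const_add x
    have h4 : HasDerivAt φ (deriv φ x) (x + ((0:ℝ):ℂ) * w) := by
      simpa using (hφ x).hasDerivAt
    exact HasDerivAt.comp (h₂ := φ) (h := fun u : ℝ => x + u * w) 0 h4 h0
  have h3 := gen a ha Complex.I
  have h3' := gen _ hb Complex.I
  have r3 := gen a ha 1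
  have r3' := gen _ hb 1
  simp only [mul_one] at r3 r3'
  have e1 := h3'.unique (h3.star)
  have e2 := r3'.unique (r3.star)
  rw [e2] at e1
  have e3 : star (deriv a x) = 0 := by
    have : (star (deriv a x)) * (2 * Complex.I) = 0 := by
      have h : star (deriv a x * Complex.I) = - star (deriv a x) * Complex.I := by
        simp
      rw [h] at e1
      linear_combination e1
    simpa using this
  simpa using e3

end ThetaAux

section ThetaAux2
open MeasureTheory Set Filter Topology Pointwise

def IsTh {g : ℕ} (Γ : AddSubgroup (Fin g → ℂ)) (χ : Γ → ℂ) (f : (Fin g → ℂ) → ℂ) : Prop :=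
  Differentiable ℂ f ∧ ∀ (γ : Γ) (z : Fin g → ℂ), f (z + (γ : Fin g → ℂ)) =
    χ γ * Complex.exp ((Real.pi : ℂ) *
      Hform g (γ : Fin g → ℂ) (z + (2 : ℂ)⁻¹ • (γ : Fin g → ℂ))) * f z

noncomputable def Phi {g : ℕ} (f h : (Fin g → ℂ) → ℂ) (v z : Fin g → ℂ) : ℂ :=
  f (z + v) * (starRingEnd ℂ) (h z) *
    Complex.exp (-(Real.pi : ℂ) * Hform g z z - (Real.pi : ℂ) * Hform g z v)

variable {g : ℕ} {Γ : AddSubgroup (Fin g → ℂ)} {χ : Γ → ℂ} {f h : (Fin g → ℂ) → ℂ}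

lemma Phi_cont (hf : Continuous f) (hh : Continuous h) :
    Continuous (fun p : (Fin g → ℂ) × (Fin g → ℂ) => Phi f h p.1 p.2) := by
  unfold Phi
  have h1 : Continuous (fun p : (Fin g → ℂ) × (Fin g → ℂ) => Hform g p.2 p.2) :=
    Hf_cont' continuous_snd continuous_snd
  have h2 : Continuous (fun p : (Fin g → ℂ) × (Fin g → ℂ) => Hform g p.2 p.1) :=
    Hf_cont' continuous_snd continuous_fst
  have h3 : Continuous (fun p : (Fin g → ℂ) × (Fin g → ℂ) => (starRingEnd ℂ) (h p.2)) :=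
    Complex.continuous_conj.comp (hh.comp continuous_snd)
  fun_prop

lemma Phi_periodic (hχ : ∀ γ, χ γ * (starRingEnd ℂ) (χ γ) = 1) (hf : IsTh Γ χ f) (hh : IsTh Γ χ h)
    (v z : Fin g → ℂ) (γ : Γ) : Phi f h v (z + γ) = Phi f h v z := by
  unfold Phi
  have e : z + (γ : Fin g → ℂ) + v = (z + v) + γ := by abel
  rw [e, hf.2, hh.2]
  simp only [map_mul, ← Complex.exp_conj, Complex.conj_ofReal, Hf_conj]
  set P : ℂ := (Real.pi : ℂ)
  have : Complex.exp (P * Hform g (γ : Fin g → ℂ) (z + v + (2 : ℂ)⁻¹ • (γ : Fin g → ℂ))) *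
      Complex.exp (P * Hform g (z + (2 : ℂ)⁻¹ • (γ : Fin g → ℂ)) (γ : Fin g → ℂ)) *
      Complex.exp (-P * Hform g (z + γ) (z + γ) - P * Hform g (z + γ) v) =
      Complex.exp (-P * Hform g z z - P * Hform g z v) := by
    rw [← Complex.exp_add, ← Complex.exp_add]
    congr 1
    simp only [Hf_add_left, Hf_add_right, Hf_smul_left, Hf_smul_right, map_inv₀, map_ofNat]
    ring
  rw [← this]
  linear_combination (f (z + v) * (starRingEnd ℂ) (h z) *
    (Complex.exp (P * Hform g (γ : Fin g → ℂ) (z + v + (2 : ℂ)⁻¹ • (γ : Fin g → ℂ))) *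
      Complex.exp (P * Hform g (z + (2 : ℂ)⁻¹ • (γ : Fin g → ℂ)) (γ : Fin g → ℂ)) *
      Complex.exp (-P * Hform g (z + γ) (z + γ) - P * Hform g (z + γ) v))) * hχ γ

lemma int_translate [Countable Γ] {F : Set (Fin g → ℂ)} (hF : IsAddFundamentalDomain Γ F volume)
    (φ : (Fin g → ℂ) → ℂ) (hφ : ∀ z (γ : Γ), φ (z + γ) = φ z) (u : Fin g → ℂ) :
    ∫ z in F, φ (z + u) = ∫ z in F, φ z := by
  have hF' : IsAddFundamentalDomain Γ (u +ᵥ F) (volume : Measure (Fin g → ℂ)) := hF.vadd_of_comm u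
  have h1 := hF.setIntegral_eq hF' (f := φ) (by
    intro γ x
    change φ ((γ : Fin g → ℂ) + x) = φ x
    rw [add_comm, hφ])
  rw [h1]
  have h2 := (measurePreserving_vadd u (volume : Measure (Fin g → ℂ))).setIntegral_image_emb
    (measurableEmbedding_const_vadd u) φ F
  rw [← Set.image_vadd, h2]
  simp only [vadd_eq_add, add_comm]

noncomputable def Aint (F : Set (Fin g → ℂ)) (f h : (Fin g → ℂ) → ℂ) (v : Fin g → ℂ) : ℂ :=
  ∫ z in F, Phi f h v z

lemma Aint_conj [Countable Γ] {F : Set (Fin g → ℂ)} (hF : IsAddFundamentalDomain Γ F volume)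
    (hχ : ∀ γ, χ γ * (starRingEnd ℂ) (χ γ) = 1) (hf : IsTh Γ χ f) (hh : IsTh Γ χ h)
    (v : Fin g → ℂ) : (starRingEnd ℂ) (Aint F f h (-v)) = Aint F h f v := by
  unfold Aint
  rw [← int_translate hF _ (fun z γ => Phi_periodic hχ hf hh (-v) z γ) v, ← integral_conj]
  congr 1
  ext z
  unfold Phi
  simp only [map_mul, ← Complex.exp_conj, Complex.conj_ofReal, Hf_conj, map_sub, map_neg,
    Complex.conj_conj, add_neg_cancel_right]
  rw [mul_comm ((starRingEnd ℂ) (f z))]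
  congr 2
  simp only [Hf_add_left, Hf_add_right, Hf_neg_left]
  ring

lemma Aint_diff {F : Set (Fin g → ℂ)} (hFb : Bornology.IsBounded F)
    (hf : Differentiable ℂ f) (hh : Differentiable ℂ h) (v : Fin g → ℂ) :
    Differentiable ℂ (fun t : ℂ => Aint F f h (t • v)) := by
  unfold Aint
  refine diff_int hFb (fun t z => Phi f h (t • v) z) ?_ ?_
  · exact (Phi_cont hf.continuous hh.continuous).comp
      ((continuous_fst.smul continuous_const).prodMk continuous_snd)
  · intro z
    unfold Phi
    simp only [Hf_smul_right]
    have : Differentiable ℂ (fun t : ℂ => f (z + t • v)) :=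
      hf.comp ((differentiable_const z).add (differentiable_id.smul_const v))
    fun_prop

lemma Aint_const [Countable Γ] {F : Set (Fin g → ℂ)} (hF : IsAddFundamentalDomain Γ F volume)
    (hFb : Bornology.IsBounded F)
    (hχ : ∀ γ, χ γ * (starRingEnd ℂ) (χ γ) = 1) (hf : IsTh Γ χ f) (hh : IsTh Γ χ h)
    (v : Fin g → ℂ) : Aint F f h v = Aint F f h 0 := by
  have := const_of_conj (a := fun t : ℂ => Aint F f h (t • v)) (Aint_diff hFb hf.1 hh.1 v) (by
    have h1 := Aint_diff hFb hh.1 hf.1 (-v)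
    have h2 : (fun t : ℂ => (starRingEnd ℂ) (Aint F f h (t • v))) =
        fun t : ℂ => Aint F h f (t • (-v)) := by
      ext t
      rw [← Aint_conj hF hχ hf hh (t • (-v))]
      simp
    rw [h2]; exact h1) 1 0
  simpa using this

/-- Fourier coefficients of `Phi`. -/
lemma Phi_coeff [Countable Γ] {F : Set (Fin g → ℂ)} (hF : IsAddFundamentalDomain Γ F volume)
    (hFb : Bornology.IsBounded F)
    (hχ : ∀ γ, χ γ * (starRingEnd ℂ) (χ γ) = 1) (hf : IsTh Γ χ f) (hh : IsTh Γ χ h)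
    (v : Fin g → ℂ) (γ : Γ) :
    ∫ z in F, Complex.exp (2 * Real.pi * Complex.I * ((Hform g γ z).im : ℂ)) * Phi f h v z =
      Aint F f h 0 * ((starRingEnd ℂ) (χ γ) *
        Complex.exp (-(Real.pi : ℂ) / 2 * Hform g γ γ - Real.pi * Hform g γ v)) := by
  rw [← Aint_const hF hFb hχ hf hh (v + γ)]
  unfold Aint
  rw [← integral_mul_const]
  congr 1
  ext z
  unfold Phi
  rw [← add_assoc, hf.2]
  set P : ℂ := (Real.pi : ℂ)
  have e0 : (2 * P * Complex.I * ((Hform g γ z).im : ℂ)) =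
      P * (Hform g γ z - Hform g z γ) := by rw [Hf_swap]; ring
  rw [e0]
  have : Complex.exp (P * (Hform g γ z - Hform g z γ)) *
      Complex.exp (-P * Hform g z z - P * Hform g z v) =
      Complex.exp (P * Hform g (γ : Fin g → ℂ) (z + v + (2 : ℂ)⁻¹ • (γ : Fin g → ℂ))) *
      Complex.exp (-P * Hform g z z - P * Hform g z (v + γ)) *
      Complex.exp (-P / 2 * Hform g γ γ - P * Hform g γ v) := by
    simp only [← Complex.exp_add]
    congr 1
    simp only [Hf_add_right, Hf_smul_right]
    ring
  have hc := hχ γ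
  linear_combination (f (z + v) * (starRingEnd ℂ) (h z)) * this -
    (f (z + v) * (starRingEnd ℂ) (h z)) *
     (Complex.exp (P * Hform g (γ : Fin g → ℂ) (z + v + (2 : ℂ)⁻¹ • (γ : Fin g → ℂ))) *
      Complex.exp (-P * Hform g z z - P * Hform g z (v + γ)) *
      Complex.exp (-P / 2 * Hform g γ γ - P * Hform g γ v)) * hc

end ThetaAux2

section ThetaAux3
open MeasureTheory Set Filter Topology Pointwise Module

variable {g : ℕ} {ι : Type} [Fintype ι]

lemma eqL_symm_apply (b : Basis ι ℝ (Fin g → ℂ)) (x : ι → ℝ) :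
    b.equivFunL.symm x = ∑ i, x i • b i := b.equivFun_symm_apply x

lemma repr_eqL_symm (b : Basis ι ℝ (Fin g → ℂ)) (x : ι → ℝ) (i : ι) :
    b.repr (b.equivFunL.symm x) i = x i := congrFun (b.equivFunL.apply_symm_apply x) i

lemma mp_equiv (b : Basis ι ℝ (Fin g → ℂ)) (hvol : volume (ZSpan.fundamentalDomain b) = 1) :
    MeasurePreserving b.equivFunL.symm volume volume := by
  refine ⟨b.equivFunL.symm.continuous.measurable, ?_⟩
  have : (Measure.map b.equivFunL.symm (volume : Measure (ι → ℝ))).IsAddHaarMeasure :=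
    b.equivFunL.symm.isAddHaarMeasure_map _
  have h := Measure.isAddLeftInvariant_eq_smul (Measure.map b.equivFunL.symm (volume : Measure (ι → ℝ)))
    (volume : Measure (Fin g → ℂ))
  set c := Measure.addHaarScalarFactor (Measure.map b.equivFunL.symm (volume : Measure (ι → ℝ)))
    (volume : Measure (Fin g → ℂ))
  have h1 : Measure.map b.equivFunL.symm (volume : Measure (ι → ℝ)) (ZSpan.fundamentalDomain b) = 1 := by
    rw [Measure.map_apply b.equivFunL.symm.continuous.measurable
      (ZSpan.fundamentalDomain_measurableSet b)]
    have : (b.equivFunL.symm ⁻¹' ZSpan.fundamentalDomain b) = Set.pi univ fun _ => Ico (0:ℝ) 1 := by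
      ext x
      simp [ZSpan.mem_fundamentalDomain, repr_eqL_symm]
    rw [this, Real.volume_pi_Ico]
    simp
  rw [h] at h1
  simp only [Measure.smul_apply, hvol] at h1
  have h2 : c = 1 := by simpa using h1
  rw [h, h2, one_smul]

lemma int_cube (b : Basis ι ℝ (Fin g → ℂ)) (hvol : volume (ZSpan.fundamentalDomain b) = 1)
    (φ : (Fin g → ℂ) → ℂ) :
    ∫ x in {x : ι → ℝ | ∀ i, x i ∈ Ioc (0:ℝ) (0 + 1)}, φ (b.equivFunL.symm x) =
      ∫ z in ZSpan.fundamentalDomain b, φ z := by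
  rw [← (mp_equiv b hvol).setIntegral_preimage_emb
    b.equivFunL.symm.toHomeomorph.measurableEmbedding φ]
  have h1 : (b.equivFunL.symm ⁻¹' ZSpan.fundamentalDomain b) = Set.pi univ fun _ => Ico (0:ℝ) 1 := by
    ext x
    simp [ZSpan.mem_fundamentalDomain, repr_eqL_symm]
  have h2 : {x : ι → ℝ | ∀ i, x i ∈ Ioc (0:ℝ) (0 + 1)} = Set.pi univ fun _ => Ioc (0:ℝ) 1 := by
    ext x; simp
  rw [h1, h2]
  refine setIntegral_congr_set ?_
  exact (Measure.univ_pi_Ioc_ae_eq_Icc (f := fun _ : ι => (0:ℝ)) (g := fun _ => 1)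
    (μ := fun _ => volume)).trans
    (Measure.univ_pi_Ico_ae_eq_Icc (f := fun _ : ι => (0:ℝ)) (g := fun _ => 1)
    (μ := fun _ => volume)).symm

lemma fourier_exp (b : Basis ι ℝ (Fin g → ℂ)) (hvol : volume (ZSpan.fundamentalDomain b) = 1)
    (φ : (Fin g → ℂ) → ℂ) (hc : Continuous φ)
    (hper : ∀ z, ∀ m : ι → ℤ, φ (z + ∑ i, (m i : ℝ) • b i) = φ z)
    (c : (ι → ℤ) → ℂ) (hs : Summable c)
    (hcoef : ∀ n, ∫ z in ZSpan.fundamentalDomain b,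
      Complex.exp (-(2 * Real.pi * Complex.I * ∑ i, (n i : ℂ) * (b.repr z i : ℂ))) * φ z = c n)
    (z : Fin g → ℂ) :
    HasSum (fun n => c n * Complex.exp (2 * Real.pi * Complex.I * ∑ i, (n i : ℂ) * (b.repr z i : ℂ)))
      (φ z) := by
  let p : (ι → ℝ) → UnitAddTorus ι := fun x i => (x i : UnitAddCircle)
  have hp : IsOpenQuotientMap p :=
    IsOpenQuotientMap.piMap (fun i => QuotientAddGroup.isOpenQuotientMap_mk)
  let ψ : UnitAddTorus ι → ℂ := fun t => φ (b.equivFunL.symm (Function.surjInv hp.surjective t))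
  have hψ : ∀ x, ψ (p x) = φ (b.equivFunL.symm x) := by
    intro x
    have h1 := Function.surjInv_eq hp.surjective (p x)
    set y := Function.surjInv hp.surjective (p x)
    have h2 : ∀ i, ∃ m : ℤ, x i + m = y i := by
      intro i
      have h3 : ((y i : ℝ) : UnitAddCircle) = (x i : UnitAddCircle) := congrFun h1 i
      obtain ⟨m, hm⟩ := (QuotientAddGroup.eq_iff_sub_mem.1 h3)
      refine ⟨m, ?_⟩
      simp at hm
      linarith
    choose m hm using h2
    have : b.equivFunL.symm y = b.equivFunL.symm x + ∑ i, (m i : ℝ) • b i := by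
      have e : y = x + fun i => (m i : ℝ) := by ext i; simp [hm]
      rw [e, map_add]
      congr 1
      exact eqL_symm_apply b _
    change φ (b.equivFunL.symm y) = _
    rw [this, hper]
  have hψc : Continuous ψ := by
    rw [hp.isQuotientMap.continuous_iff]
    have : ψ ∘ p = fun x => φ (b.equivFunL.symm x) := funext hψ
    rw [this]
    exact hc.comp b.equivFunL.symm.continuous
  have hexp : ∀ (n : ι → ℤ) (x : ι → ℝ), UnitAddTorus.mFourier n (p x) =
      Complex.exp (2 * Real.pi * Complex.I * ∑ i, (n i : ℂ) * (x i : ℂ)) := by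
    intro n x
    simp only [UnitAddTorus.mFourier, ContinuousMap.coe_mk, p, fourier_coe_apply, Finset.mul_sum,
      Complex.exp_sum]
    refine Finset.prod_congr rfl fun i _ => ?_
    congr 1
    push_cast
    ring
  let Ψ : C(UnitAddTorus ι, ℂ) := ⟨ψ, hψc⟩
  have hco : ∀ n, UnitAddTorus.mFourierCoeff Ψ n = c n := by
    intro n
    rw [UnitAddTorus.mFourierCoeff_eq_integral _ n 0, ← hcoef n, ← int_cube b hvol]
    refine setIntegral_congr_fun ?_ ?_
    · have h2 : {x : ι → ℝ | ∀ i, x i ∈ Ioc ((0 : ι → ℝ) i) ((0 : ι → ℝ) i + 1)} =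
        Set.pi univ fun _ => Ioc (0:ℝ) 1 := by
        ext x; simp
      rw [h2]
      exact MeasurableSet.univ_pi fun _ => measurableSet_Ioc
    · intro x _
      have h1 := hexp (-n) x
      have h2 := hψ x
      change UnitAddTorus.mFourier (-n) (p x) • ψ (p x) = _
      rw [h1, h2, smul_eq_mul]
      simp [repr_eqL_symm]
  have hfin := UnitAddTorus.hasSum_mFourier_series_apply_of_summable (f := Ψ)
    (by rw [funext hco]; exact hs) (p (b.equivFunL z))
  simp only [hco, hexp] at hfin
  have h2 := hψ (b.equivFunL z)
  change HasSum _ (ψ (p (b.equivFunL z))) at hfin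
  rw [h2] at hfin
  simpa using hfin

end ThetaAux3

section ThetaAux4
open MeasureTheory Set Filter Topology Pointwise Module

variable {g : ℕ} {ι : Type} [Fintype ι]

lemma gauss_bound (k : ℕ) (M : ℝ) : ∃ C : ℝ, ∀ r : ℝ, 0 < r →
    Real.exp (-Real.pi / 2 * r ^ 2 + Real.pi * M * r) ≤ C * (r ^ k)⁻¹ := by
  refine ⟨Real.exp ((Real.pi * M + 1) ^ 2 / (2 * Real.pi)) * k.factorial, fun r hr => ?_⟩
  have h1 : -Real.pi / 2 * r ^ 2 + Real.pi * M * r ≤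
      (Real.pi * M + 1) ^ 2 / (2 * Real.pi) - r := by
    have hp := Real.pi_pos
    have : (Real.pi * M + 1) ^ 2 / (2 * Real.pi) - r - (-Real.pi / 2 * r ^ 2 + Real.pi * M * r) =
      (Real.pi * M + 1 - Real.pi * r) ^ 2 / (2 * Real.pi) := by field_simp; ring
    have h2 : 0 ≤ (Real.pi * M + 1 - Real.pi * r) ^ 2 / (2 * Real.pi) := by positivity
    linarith
  have h2 := Real.pow_div_factorial_le_exp r hr.le k
  have h3 : Real.exp (-r) ≤ k.factorial * (r ^ k)⁻¹ := by
    rw [Real.exp_neg]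
    have h4 : 0 < r ^ k / k.factorial := by positivity
    calc (Real.exp r)⁻¹ ≤ (r ^ k / k.factorial)⁻¹ := inv_anti₀ h4 h2
      _ = _ := by rw [inv_div]; rfl
  calc _ ≤ Real.exp ((Real.pi * M + 1) ^ 2 / (2 * Real.pi) - r) := Real.exp_le_exp.2 h1
    _ = Real.exp ((Real.pi * M + 1) ^ 2 / (2 * Real.pi)) * Real.exp (-r) := by
        rw [← Real.exp_add]; rfl
    _ ≤ _ := by rw [mul_assoc]; gcongr

lemma gauss_norm_le (x v : Fin g → ℂ) :
    ‖Complex.exp (-(Real.pi : ℂ) / 2 * Hform g x x - Real.pi * Hform g x v)‖ ≤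
      Real.exp (-Real.pi / 2 * ‖x‖ ^ 2 + Real.pi * (∑ j, ‖v j‖) * ‖x‖) := by
  rw [Complex.norm_exp, Real.exp_le_exp]
  have h1 : ‖x‖ ^ 2 ≤ ∑ j, ‖x j‖ ^ 2 := by
    have h0 : 0 ≤ ∑ j, ‖x j‖ ^ 2 := Finset.sum_nonneg fun j _ => by positivity
    have : ‖x‖ ≤ Real.sqrt (∑ j, ‖x j‖ ^ 2) := by
      rw [pi_norm_le_iff_of_nonneg (Real.sqrt_nonneg _)]
      intro j
      apply Real.le_sqrt_of_sq_le
      exact Finset.single_le_sum (f := fun j => ‖x j‖ ^ 2) (fun j _ => by positivity)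
        (Finset.mem_univ j)
    calc ‖x‖ ^ 2 ≤ (Real.sqrt (∑ j, ‖x j‖ ^ 2)) ^ 2 := by gcongr
      _ = _ := Real.sq_sqrt h0
  have h2 : ‖Hform g x v‖ ≤ (∑ j, ‖v j‖) * ‖x‖ := by
    unfold Hform
    rw [Finset.sum_mul]
    refine (norm_sum_le _ _).trans (Finset.sum_le_sum fun j _ => ?_)
    rw [norm_mul, RCLike.norm_conj, mul_comm]
    gcongr
    exact norm_le_pi_norm x j
  have h3 : -(Hform g x v).re ≤ (∑ j, ‖v j‖) * ‖x‖ :=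
    ((neg_le_abs _).trans (Complex.abs_re_le_norm _)).trans h2
  have e : (-(Real.pi : ℂ) / 2 * Hform g x x - Real.pi * Hform g x v).re =
      -Real.pi / 2 * (∑ j, ‖x j‖ ^ 2) + Real.pi * (-(Hform g x v).re) := by
    have e1 : (-(Real.pi : ℂ) / 2 * Hform g x x - Real.pi * Hform g x v) =
      ((-Real.pi / 2 * (∑ j, ‖x j‖ ^ 2) : ℝ) : ℂ) - (Real.pi : ℂ) * Hform g x v := by
      rw [Hf_self]; push_cast; ring
    rw [e1, Complex.sub_re, Complex.ofReal_re, Complex.re_ofReal_mul]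
    ring
  rw [e, mul_assoc]
  have hp := Real.pi_pos
  have h4 : Real.pi * (-(Hform g x v).re) ≤ Real.pi * ((∑ j, ‖v j‖) * ‖x‖) := by gcongr
  have h5 : Real.pi / 2 * ‖x‖ ^ 2 ≤ Real.pi / 2 * (∑ j, ‖x j‖ ^ 2) := by gcongr
  linarith

lemma gauss_summable (b : Basis ι ℝ (Fin g → ℂ)) {Γ : AddSubgroup (Fin g → ℂ)}
    (hΓ : Γ = (Submodule.span ℤ (range b)).toAddSubgroup) (v : Fin g → ℂ) :
    Summable (fun γ : Γ =>
      Complex.exp (-(Real.pi : ℂ) / 2 * Hform g γ γ - Real.pi * Hform g γ v)) := by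
  subst hΓ
  change Summable (fun γ : (Submodule.span ℤ (range b)) =>
      Complex.exp (-(Real.pi : ℂ) / 2 * Hform g γ γ - Real.pi * Hform g γ v))
  set k := finrank ℤ (Submodule.span ℤ (range b)) + 1
  obtain ⟨C, hC⟩ := gauss_bound k (∑ j, ‖v j‖)
  have hs := (ZLattice.summable_norm_pow_inv (L := Submodule.span ℤ (range b)) k
    (Nat.lt_succ_self _)).mul_left C
  refine Summable.of_norm_bounded_eventually hs ?_
  have : ∀ᶠ γ : (Submodule.span ℤ (range b)) in cofinite, γ ≠ 0 := by
    simp [Filter.eventually_cofinite]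
  filter_upwards [this] with γ hγ
  refine (gauss_norm_le _ _).trans ?_
  have := hC ‖(γ : Fin g → ℂ)‖ (by simpa using hγ)
  simpa using this

variable {Γ : AddSubgroup (Fin g → ℂ)} {χ : Γ → ℂ} {f h : (Fin g → ℂ) → ℂ}

lemma Hf_im_repr (b : Basis ι ℝ (Fin g → ℂ)) (x z : Fin g → ℂ) :
    (Hform g x z).im = ∑ i, (Hform g x (b i)).im * b.repr z i := by
  have key : ∀ (s : Finset ι) (c : ι → ℝ), (Hform g x (∑ i ∈ s, c i • b i)).im =
      ∑ i ∈ s, (Hform g x (b i)).im * c i := by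
    classical
    intro s c
    induction s using Finset.induction_on with
    | empty => simp [Hform]
    | insert i s hi ih =>
      rw [Finset.sum_insert hi, Finset.sum_insert hi, Hf_add_right, Complex.add_im, ih]
      congr 1
      have : (c i • b i : Fin g → ℂ) = (c i : ℂ) • b i := by
        ext j; simp
      rw [this, Hf_smul_right, Complex.im_ofReal_mul, mul_comm]
  conv_lhs => rw [← b.sum_repr z]
  exact key Finset.univ _

lemma fd_of (b : Basis ι ℝ (Fin g → ℂ))
    (hΓ : Γ = (Submodule.span ℤ (range b)).toAddSubgroup) :
    IsAddFundamentalDomain Γ (ZSpan.fundamentalDomain b) (volume : Measure (Fin g → ℂ)) := by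
  subst hΓ
  exact ZSpan.isAddFundamentalDomain' b volume

lemma theta_expand [Countable Γ] (b : Basis ι ℝ (Fin g → ℂ))
    (hvol : volume (ZSpan.fundamentalDomain b) = 1)
    (hΓ : Γ = (Submodule.span ℤ (range b)).toAddSubgroup)
    (ν : Γ ≃ (ι → ℤ)) (hν : ∀ (γ : Γ) i, (Hform g γ (b i)).im = -(ν γ i : ℝ))
    (hχ : ∀ γ, χ γ * (starRingEnd ℂ) (χ γ) = 1) (hf : IsTh Γ χ f) (hh : IsTh Γ χ h)
    (v z : Fin g → ℂ) :
    HasSum (fun γ : Γ => Aint (ZSpan.fundamentalDomain b) f h 0 * ((starRingEnd ℂ) (χ γ) *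
        Complex.exp (-(Real.pi : ℂ) / 2 * Hform g γ γ - Real.pi * Hform g γ v)) *
        Complex.exp (-(2 * Real.pi * Complex.I * ((Hform g γ z).im : ℂ)))) (Phi f h v z) := by
  have hF := fd_of b hΓ
  have hFb := ZSpan.fundamentalDomain_isBounded b
  set A0 := Aint (ZSpan.fundamentalDomain b) f h 0 with hA0
  let c0 : Γ → ℂ := fun γ => A0 * ((starRingEnd ℂ) (χ γ) *
        Complex.exp (-(Real.pi : ℂ) / 2 * Hform g γ γ - Real.pi * Hform g γ v))
  have hν' : ∀ (n : ι → ℤ) (w : Fin g → ℂ), ((Hform g (ν.symm n : Γ) w).im : ℂ) =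
      - ∑ i, (n i : ℂ) * (b.repr w i : ℂ) := by
    intro n w
    rw [Hf_im_repr b]
    simp only [hν, Equiv.apply_symm_apply]
    push_cast
    simp
  have hχn : ∀ γ, ‖(starRingEnd ℂ) (χ γ)‖ = 1 := by
    intro γ
    have := congrArg norm (hχ γ)
    rw [norm_mul, RCLike.norm_conj, norm_one] at this
    rw [RCLike.norm_conj]
    nlinarith [norm_nonneg (χ γ)]
  have hs : Summable c0 := by
    refine Summable.mul_left _ ?_
    refine Summable.of_norm ?_
    simp only [norm_mul, hχn, one_mul]
    exact (gauss_summable b hΓ v).norm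
  have hper : ∀ w, ∀ m : ι → ℤ, Phi f h v (w + ∑ i, (m i : ℝ) • b i) = Phi f h v w := by
    intro w m
    have hm : (∑ i, (m i : ℝ) • b i) ∈ Γ := by
      rw [hΓ]
      refine Submodule.sum_mem _ fun i _ => ?_
      have : ((m i : ℝ) • b i : Fin g → ℂ) = m i • b i := Int.cast_smul_eq_zsmul ℝ _ _
      rw [this]
      exact Submodule.smul_mem _ _ (Submodule.subset_span ⟨i, rfl⟩)
    exact Phi_periodic hχ hf hh v w ⟨_, hm⟩
  have hcont : Continuous (Phi f h v) :=
    (Phi_cont hf.1.continuous hh.1.continuous).comp (Continuous.prodMk_right v)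
  have key := fourier_exp b hvol (Phi f h v) hcont hper (c0 ∘ ν.symm)
    ((ν.symm.summable_iff).2 hs) (by
      intro n
      have := Phi_coeff hF hFb hχ hf hh v (ν.symm n)
      simp only [hν'] at this
      simp only [Function.comp, c0]
      rw [← this]
      congr 1
      ext w
      congr 2
      ring) z
  rw [← ν.symm.hasSum_iff]
  convert key using 2 with n
  simp only [Function.comp, c0]
  congr 2
  rw [hν']
  ring

end ThetaAux4

section ThetaAux5
open MeasureTheory Set Filter Topology Pointwise Module

variable {g : ℕ} {Γ : AddSubgroup (Fin g → ℂ)}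

noncomputable def kg (z : Fin g → ℂ) : ℂ :=
  Complex.exp (-((Real.pi : ℂ) * (1 - Complex.I)) * Hform g z z)

lemma kg_eq (z : Fin g → ℂ) : kg z =
    ∏ j, Complex.exp (-((Real.pi : ℂ) * (1 - Complex.I)) * (‖z j‖ : ℂ) ^ 2) := by
  unfold kg
  rw [← Complex.exp_sum, ← Finset.mul_sum, Hf_self]
  push_cast
  rfl

lemma kg_re : 0 < ((Real.pi : ℂ) * (1 - Complex.I)).re := by
  simp [Real.pi_pos]

lemma kg_integrable : Integrable (kg (g := g)) := by
  have h1 : Integrable (fun z : ℂ =>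
      Complex.exp (-((Real.pi : ℂ) * (1 - Complex.I)) * (‖z‖ : ℂ) ^ 2)) := by
    simpa using GaussianFourier.integrable_cexp_neg_mul_sq_norm_add kg_re 0 (0 : ℂ)
  have h2 := Integrable.fintype_prod (ι := Fin g) (fun _ => h1)
  exact h2.congr (Eventually.of_forall fun z => (kg_eq z).symm)

lemma kg_integral : ∫ z : Fin g → ℂ, kg z = (1 - Complex.I) ^ (-(g : ℤ)) := by
  have h1 : ∫ z : ℂ, Complex.exp (-((Real.pi : ℂ) * (1 - Complex.I)) * (‖z‖ : ℂ) ^ 2) =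
      (1 - Complex.I)⁻¹ := by
    rw [GaussianFourier.integral_cexp_neg_mul_sq_norm kg_re, Complex.finrank_real_complex]
    have : (1 - Complex.I) ≠ 0 := by
      intro h; simpa using congrArg Complex.re h
    have hp : (Real.pi : ℂ) ≠ 0 := by exact_mod_cast Real.pi_ne_zero
    norm_num
    field_simp
  simp only [kg_eq]
  rw [integral_fintype_prod_volume_eq_pow
    (fun z : ℂ => Complex.exp (-((Real.pi : ℂ) * (1 - Complex.I)) * (‖z‖ : ℂ) ^ 2)), h1]
  simp

lemma unfold_hasSum {V : Type*} [NormedAddCommGroup V] [NormedSpace ℝ V] [Countable Γ]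
    {F : Set (Fin g → ℂ)} (hF : IsAddFundamentalDomain Γ F volume)
    (k : (Fin g → ℂ) → V) (hk : Integrable k) :
    HasSum (fun γ : Γ => ∫ z in F, k (z - γ)) (∫ z, k z) := by
  have h1 := hasSum_integral_iUnion_ae (μ := (volume : Measure (Fin g → ℂ))) (f := k)
    (s := fun γ : Γ => γ +ᵥ F) (fun γ => hF.nullMeasurableSet_vadd γ) hF.aedisjoint
    hk.integrableOn
  rw [setIntegral_congr_set hF.iUnion_vadd_ae_eq, setIntegral_univ,
    ← (Equiv.neg Γ).hasSum_iff] at h1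
  convert h1 using 2 with γ
  simp only [Function.comp, Equiv.neg_apply]
  have h2 := (measurePreserving_vadd (-γ : Γ) (volume : Measure (Fin g → ℂ))).setIntegral_image_emb
    (measurableEmbedding_const_vadd (-γ)) k F
  rw [← Set.image_vadd, h2]
  congr 1
  ext z
  congr 1
  change _ = -(γ : Fin g → ℂ) + z
  abel

lemma kg_cont : Continuous (kg (g := g)) := by
  unfold kg
  have := Hf_cont' (g := g) continuous_id continuous_id
  simp only [id] at this
  fun_prop

lemma trace_int [Countable Γ] {F : Set (Fin g → ℂ)} (hF : IsAddFundamentalDomain Γ F volume)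
    {A : Type*} [Fintype A] (T : A × Γ ≃ Γ) (p : Γ → Fin g → ℂ) (p0 : A → Fin g → ℂ)
    (hp : ∀ a d, p (T (a, d)) = p0 a + d) (ψ : Γ → ℂ) (w : A → ℂ) (hψ : ∀ a d, ψ (T (a, d)) = w a)
    (A0 : ℂ) (φ : (Fin g → ℂ) → ℂ)
    (hφ : ∀ z, HasSum (fun γ => A0 * ψ γ * kg (z - p γ)) (φ z)) :
    ∫ z in F, φ z = A0 * (∑ a, w a) * (1 - Complex.I) ^ (-(g : ℤ)) := by
  let G : A × Γ → (Fin g → ℂ) → ℂ := fun x z => A0 * w x.1 * kg (z - (x.2 : Fin g → ℂ) - p0 x.1)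
  have hG : ∀ z, HasSum (fun x => G x z) (φ z) := by
    intro z
    have h := hφ z
    rw [← T.hasSum_iff] at h
    convert h using 2 with x
    obtain ⟨a, d⟩ := x
    simp only [Function.comp, hψ, hp, G]
    congr 2
    abel
  have hk : ∀ a, Integrable (fun z => A0 * w a * kg (z - p0 a)) := fun a =>
    (kg_integrable.comp_sub_right (p0 a)).const_mul _
  have hGi : ∀ x, Integrable (G x) (volume.restrict F) := fun x =>
    (((hk x.1).comp_sub_right (x.2 : Fin g → ℂ))).integrableOn
  have hsum : ∀ a, HasSum (fun d => ∫ z in F, G (a, d) z)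
      (A0 * w a * (1 - Complex.I) ^ (-(g : ℤ))) := by
    intro a
    have h := unfold_hasSum hF _ (hk a)
    rw [integral_const_mul, integral_sub_right_eq_self (kg (g := g)), kg_integral] at h
    exact h
  have hnorm : Summable fun x => ∫ z in F, ‖G x z‖ := by
    rw [summable_prod_of_nonneg (fun x => integral_nonneg fun z => norm_nonneg _)]
    refine ⟨fun a => ?_, Summable.of_finite⟩
    exact (unfold_hasSum hF _ (hk a).norm).summable
  have h1 := hasSum_integral_of_summable_integral_norm hGi hnorm
  have h2 : (∫ z in F, ∑' x, G x z) = ∫ z in F, φ z := by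
    congr 1; ext z; exact (hG z).tsum_eq
  rw [h2] at h1
  have h3 := h1.prod_fiberwise hsum
  rw [h3.unique (hasSum_fintype _), Finset.mul_sum, Finset.sum_mul]

variable {χ : Γ → ℂ} {f h : (Fin g → ℂ) → ℂ}

lemma zero_of_mul (hf : Differentiable ℂ f) (hh : Continuous h)
    (h0 : ∀ z, f z * h z = 0) (z0 : Fin g → ℂ) (hz0 : h z0 ≠ 0) : f = 0 := by
  ext z
  have hd : Differentiable ℂ (fun t : ℂ => f (z0 + t • (z - z0))) :=
    hf.comp ((differentiable_const z0).add (differentiable_id.smul_const _))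
  have ha : AnalyticOnNhd ℂ (fun t : ℂ => f (z0 + t • (z - z0))) univ :=
    fun t _ => hd.analyticAt t
  have hev : (fun t : ℂ => f (z0 + t • (z - z0))) =ᶠ[𝓝 0] 0 := by
    have hc : Continuous (fun t : ℂ => h (z0 + t • (z - z0))) := by fun_prop
    have := hc.continuousAt.eventually_ne (x := 0) (y := 0) (by simpa using hz0)
    filter_upwards [this] with t ht
    exact (mul_eq_zero.1 (h0 _)).resolve_right ht
  have := ha.eqOn_zero_of_preconnected_of_eventuallyEq_zero isPreconnected_univ (mem_univ 0) hev
    (mem_univ 1)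
  simpa using this

lemma theta_zero {ι : Type} [Fintype ι] [Countable Γ] (b : Basis ι ℝ (Fin g → ℂ))
    (hvol : volume (ZSpan.fundamentalDomain b) = 1)
    (hΓ : Γ = (Submodule.span ℤ (range b)).toAddSubgroup)
    (ν : Γ ≃ (ι → ℤ)) (hν : ∀ (γ : Γ) i, (Hform g γ (b i)).im = -(ν γ i : ℝ))
    (hχ : ∀ γ, χ γ * (starRingEnd ℂ) (χ γ) = 1) (hf : IsTh Γ χ f) (hh : IsTh Γ χ h)
    (hne : h ≠ 0) (hA : Aint (ZSpan.fundamentalDomain b) f h 0 = 0) : f = 0 := by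
  obtain ⟨z0, hz0⟩ := Function.ne_iff.1 hne
  refine zero_of_mul (h := fun z => (starRingEnd ℂ) (h z)) hf.1
    (Complex.continuous_conj.comp hh.1.continuous) (fun z => ?_) z0 (by simpa using hz0)
  have := theta_expand b hvol hΓ ν hν hχ hf hh 0 z
  simp only [hA, zero_mul] at this
  have := this.unique hasSum_zero
  unfold Phi at this
  simpa [Complex.exp_ne_zero] using this

lemma Phi_integrable {F : Set (Fin g → ℂ)} (hFb : Bornology.IsBounded F)
    (hf : Continuous f) (hh : Continuous h) (v : Fin g → ℂ) : IntegrableOn (Phi f h v) F := by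
  have hcont : Continuous (Phi f h v) :=
    (Phi_cont hf hh).comp (Continuous.prodMk_right v)
  exact (hcont.continuousOn.integrableOn_compact hFb.isCompact_closure).mono_set subset_closure

lemma theta_prop {ι : Type} [Fintype ι] [Countable Γ] (b : Basis ι ℝ (Fin g → ℂ))
    (hvol : volume (ZSpan.fundamentalDomain b) = 1)
    (hΓ : Γ = (Submodule.span ℤ (range b)).toAddSubgroup)
    (ν : Γ ≃ (ι → ℤ)) (hν : ∀ (γ : Γ) i, (Hform g γ (b i)).im = -(ν γ i : ℝ))
    (hχ : ∀ γ, χ γ * (starRingEnd ℂ) (χ γ) = 1) (hf : IsTh Γ χ f) (hh : IsTh Γ χ h)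
    (hne : h ≠ 0) (C : ℂ) (hA : Aint (ZSpan.fundamentalDomain b) f h 0 =
      Aint (ZSpan.fundamentalDomain b) h h 0 * C) : ∀ z, f z = C * h z := by
  have hFb := ZSpan.fundamentalDomain_isBounded b
  have h1 : IsTh Γ χ (fun z => f z - C * h z) := by
    refine ⟨hf.1.sub (hh.1.const_mul C), fun γ z => ?_⟩
    simp only [hf.2, hh.2]; ring
  have h2 := theta_zero b hvol hΓ ν hν hχ h1 hh hne (by
    have e : ∀ z, Phi (fun z => f z - C * h z) h 0 z = Phi f h 0 z - C * Phi h h 0 z := by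
      intro z; unfold Phi; ring
    unfold Aint at hA ⊢
    simp only [e]
    rw [integral_sub (Phi_integrable hFb hf.1.continuous hh.1.continuous 0)
      ((Phi_integrable hFb hh.1.continuous hh.1.continuous 0).const_mul C),
      integral_const_mul, hA]
    ring)
  intro z
  have := congrFun h2 z
  simp only [Pi.zero_apply] at this
  linear_combination this

end ThetaAux5

section ThetaAux6
open MeasureTheory Set Filter Topology Pointwise Module Matrix

variable {g : ℕ}

noncomputable def stdB (g : ℕ) : Basis (Fin g × Fin 2) ℝ (Fin g → ℂ) :=
  (Pi.basis fun _ : Fin g => Complex.basisOneI).reindex (Equiv.sigmaEquivProd _ _)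

lemma stdB_apply (i : Fin g × Fin 2) : stdB g i = Pi.single i.1 (Complex.basisOneI i.2) := by
  simp [stdB, Pi.basis_apply]

lemma stdB_repr (z : Fin g → ℂ) (i : Fin g × Fin 2) :
    (stdB g).repr z i = Complex.basisOneI.repr (z i.1) i.2 := by
  simp [stdB, Pi.basis_repr]

lemma stdB_vol : volume (ZSpan.fundamentalDomain (stdB g)) = 1 := by
  have h1 : ZSpan.fundamentalDomain (stdB g) =
      Set.pi univ fun _ : Fin g => Complex.measurableEquivRealProd ⁻¹'
        (Ico (0:ℝ) 1 ×ˢ Ico (0:ℝ) 1) := by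
    ext z
    simp only [ZSpan.mem_fundamentalDomain, stdB_repr, Prod.forall, Fin.forall_fin_two,
      Complex.coe_basisOneI_repr]
    simp [Complex.measurableEquivRealProd]
  rw [h1, volume_pi_pi]
  have h2 : volume (Complex.measurableEquivRealProd ⁻¹'
        (Ico (0:ℝ) 1 ×ˢ Ico (0:ℝ) 1)) = 1 := by
    rw [Complex.volume_preserving_equiv_real_prod.measure_preimage
      (measurableSet_Ico.prod measurableSet_Ico).nullMeasurableSet, Measure.volume_eq_prod,
      Measure.prod_prod]
    simp
  simp [h2]

lemma Hf_rsmul_left (c : ℝ) (x y : Fin g → ℂ) : Hform g (c • x) y = c * Hform g x y := by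
  have : (c • x : Fin g → ℂ) = (c : ℂ) • x := by ext j; simp
  rw [this, Hf_smul_left, Complex.conj_ofReal]

lemma Hf_rsmul_right (c : ℝ) (x y : Fin g → ℂ) : Hform g x (c • y) = c * Hform g x y := by
  have : (c • y : Fin g → ℂ) = (c : ℂ) • y := by ext j; simp
  rw [this, Hf_smul_right]

noncomputable def Efm (g : ℕ) : LinearMap.BilinForm ℝ (Fin g → ℂ) :=
  LinearMap.mk₂ ℝ (fun x y => (Hform g x y).im)
    (by intros; simp [Hf_add_left]) (by intros; simp [Hf_rsmul_left])
    (by intros; simp [Hf_add_right]) (by intros; simp [Hf_rsmul_right])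

lemma Efm_apply (x y : Fin g → ℂ) : Efm g x y = (Hform g x y).im := rfl

lemma stdB_gram : LinearMap.BilinForm.toMatrix (stdB g) (Efm g) =
    Matrix.kronecker (1 : Matrix (Fin g) (Fin g) ℝ) !![0, 1; -1, 0] := by
  ext ⟨j, a⟩ ⟨k, c⟩
  rw [LinearMap.BilinForm.toMatrix_apply, Efm_apply, stdB_apply, stdB_apply]
  have : Hform g (Pi.single j (Complex.basisOneI a)) (Pi.single k (Complex.basisOneI c)) =
      if j = k then (starRingEnd ℂ) (Complex.basisOneI a) * Complex.basisOneI c else 0 := by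
    unfold Hform
    rw [Finset.sum_eq_single j]
    · by_cases hjk : j = k
      · subst hjk; simp
      · simp [hjk]
    · intro b _ hb; simp [hb]
    · simp
  simp only [this]
  by_cases hjk : j = k
  · simp only [hjk, if_true]
    fin_cases a <;> fin_cases c <;> simp
  · simp [hjk]

lemma stdB_det : (LinearMap.BilinForm.toMatrix (stdB g) (Efm g)).det = 1 := by
  rw [stdB_gram, Matrix.kronecker, Matrix.det_kronecker]
  simp

lemma vol_one (b : Basis (Fin g × Fin 2) ℝ (Fin g → ℂ))
    (N C : Matrix (Fin g × Fin 2) (Fin g × Fin 2) ℤ) (hCN : C * N = 1)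
    (hN : ∀ i j, (Hform g (b i) (b j)).im = N i j) :
    volume (ZSpan.fundamentalDomain b) = 1 := by
  rw [ZSpan.measure_fundamentalDomain b volume (stdB g), stdB_vol, mul_one]
  have h1 := LinearMap.BilinForm.toMatrix_mul_basis_toMatrix (stdB g) b (Efm g)
  have h2 := congrArg Matrix.det h1
  rw [Matrix.det_mul, Matrix.det_mul, Matrix.det_transpose, stdB_det, mul_one] at h2
  have h3 : LinearMap.BilinForm.toMatrix b (Efm g) = N.map (Int.castRingHom ℝ) := by
    ext i j
    rw [LinearMap.BilinForm.toMatrix_apply, Efm_apply, hN]; simp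
  have h4 : (N.map (Int.castRingHom ℝ)).det = (N.det : ℝ) :=
    ((Int.castRingHom ℝ).map_det N).symm
  have h5 : IsUnit N.det := by
    have := congrArg Matrix.det hCN
    rw [Matrix.det_mul, Matrix.det_one] at this
    exact IsUnit.of_mul_eq_one _ (by rw [mul_comm]; exact this)
  rw [h3, h4] at h2
  rw [Basis.det_apply]
  set D := ((stdB g).toMatrix b).det
  have h6 : |D| = 1 := by
    rcases Int.isUnit_iff.1 h5 with h | h
    · rw [h] at h2
      have : |D| * |D| = 1 := by rw [abs_mul_abs_self, h2]; simp
      nlinarith [abs_nonneg D]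
    · rw [h] at h2
      push_cast at h2
      nlinarith [mul_self_nonneg D]
  rw [h6]; simp

lemma setup_lattice (Γ : AddSubgroup (Fin g → ℂ))
    [Module.Free ℤ ↥Γ] [Module.Finite ℤ ↥Γ]
    (hrank : Module.finrank ℤ ↥Γ = 2 * g)
    (hspan : Submodule.span ℝ (Γ : Set (Fin g → ℂ)) = ⊤)
    (hHint : ∀ x y : ↥Γ, ∃ a b : ℤ, Hform g x y = (a : ℂ) + (b : ℂ) * Complex.I)
    (hunimod : ∀ φ : ↥Γ →ₗ[ℤ] ℤ, ∃! x : ↥Γ, ∀ y : ↥Γ, (Hform g x y).im = (φ y : ℝ)) :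
    ∃ b : Basis (Fin g × Fin 2) ℝ (Fin g → ℂ),
      volume (ZSpan.fundamentalDomain b) = 1 ∧
      Γ = (Submodule.span ℤ (range b)).toAddSubgroup ∧
      ∃ ν : Γ ≃ (Fin g × Fin 2 → ℤ), ∀ (γ : Γ) i, (Hform g γ (b i)).im = -(ν γ i : ℝ) := by
  have hE : ∀ x y : Γ, ∃ n : ℤ, (Hform g x y).im = n := by
    intro x y
    obtain ⟨a, c, h⟩ := hHint x y
    exact ⟨c, by simp [h]⟩
  choose E hE using hE
  let bZ : Basis (Fin g × Fin 2) ℤ Γ := (finBasisOfFinrankEq ℤ Γ hrank).reindex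
    (Fintype.equivOfCardEq (by simp [mul_comm]))
  have hΓ : Γ = (Submodule.span ℤ (range fun i => (bZ i : Fin g → ℂ))).toAddSubgroup := by
    apply le_antisymm
    · intro x hx
      have h := bZ.sum_repr ⟨x, hx⟩
      have h' := congrArg (Subtype.val) h
      simp only [AddSubgroup.val_finsetSum, AddSubgroup.coe_zsmul] at h'
      rw [← h']
      exact Submodule.sum_mem _ fun i _ => Submodule.smul_mem _ _ (Submodule.subset_span ⟨i, rfl⟩)
    · intro x hx
      refine Submodule.span_induction (p := fun x _ => x ∈ Γ) ?_ ?_ ?_ ?_ hx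
      · rintro _ ⟨i, rfl⟩; exact (bZ i).2
      · exact Γ.zero_mem
      · intro x y _ _ h1 h2; exact Γ.add_mem h1 h2
      · intro n x _ h; exact Γ.zsmul_mem h n
  have hsp : ⊤ ≤ Submodule.span ℝ (range fun i => (bZ i : Fin g → ℂ)) := by
    rw [← hspan]
    refine Submodule.span_le.2 ?_
    intro x hx
    have hx' : x ∈ Submodule.span ℤ (range fun i => (bZ i : Fin g → ℂ)) := by
      rw [hΓ] at hx; exact hx
    exact Submodule.span_subset_span ℤ ℝ _ hx'
  let b : Basis (Fin g × Fin 2) ℝ (Fin g → ℂ) := basisOfTopLeSpanOfCardEqFinrank _ hsp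
    (Module.finrank_eq_card_basis (stdB g)).symm
  have hb : (b : Fin g × Fin 2 → Fin g → ℂ) = fun i => (bZ i : Fin g → ℂ) :=
    coe_basisOfTopLeSpanOfCardEqFinrank _ _ _
  have hrepr : ∀ y : Γ, (y : Fin g → ℂ) = ∑ k, (bZ.repr y k : ℝ) • (bZ k : Fin g → ℂ) := by
    intro y
    have h' := congrArg (Subtype.val) (bZ.sum_repr y)
    simp only [AddSubgroup.val_finsetSum, AddSubgroup.coe_zsmul] at h'
    simp only [Int.cast_smul_eq_zsmul]
    exact h'.symm
  refine ⟨b, ?_, ?_, ?_⟩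
  · choose x hx _ using fun i => hunimod (bZ.coord i)
    refine vol_one b (Matrix.of fun i j => E (bZ i) (bZ j))
      (Matrix.of fun i k => bZ.repr (x i) k) ?_ ?_
    · ext i j
      rw [Matrix.mul_apply]
      simp only [Matrix.of_apply]
      have h := hx i (bZ j)
      rw [← Efm_apply, hrepr (x i), map_sum, LinearMap.sum_apply] at h
      simp only [map_smul, LinearMap.smul_apply, Efm_apply, hE, smul_eq_mul] at h
      have h2 : ∑ k, bZ.repr (x i) k * E (bZ k) (bZ j) = bZ.coord i (bZ j) := by exact_mod_cast h
      rw [h2]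
      simp [Matrix.one_apply, Finsupp.single_apply, eq_comm]
    · intro i j; rw [hb]; exact hE _ _
  · rw [hb]; exact hΓ
  · refine ⟨Equiv.ofBijective (fun γ i => - E γ (bZ i)) ⟨?_, ?_⟩, ?_⟩
    · intro γ γ' h
      have h' : ∀ i, E γ (bZ i) = E γ' (bZ i) := fun i => neg_injective (congrFun h i)
      let φ : Γ →ₗ[ℤ] ℤ := bZ.constr ℤ (fun i => E γ (bZ i))
      have key : ∀ w : Γ, (∀ i, E w (bZ i) = E γ (bZ i)) → ∀ y : Γ, (Hform g w y).im = (φ y : ℝ) := by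
        intro w hw y
        rw [← Efm_apply, hrepr y, map_sum, Basis.constr_apply_fintype]
        simp only [map_smul, Efm_apply, hE, smul_eq_mul, hw, Basis.equivFun_apply]
        push_cast
        rfl
      exact (hunimod φ).unique (key γ fun _ => rfl) (key γ' fun i => (h' i).symm)
    · intro n
      obtain ⟨x, hx, _⟩ := hunimod (bZ.constr ℤ (fun i => - n i))
      refine ⟨x, ?_⟩
      ext i
      have := hx (bZ i)
      rw [Basis.constr_basis, hE] at this
      have h2 : E x (bZ i) = - n i := by exact_mod_cast this
      simp [h2]
    · intro γ i
      rw [hb]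
      simp only [hE]
      change _ = -((- E γ (bZ i) : ℤ) : ℝ)
      push_cast
      ring

end ThetaAux6

section ThetaAux7

lemma iPow_add (a b : ZMod 4) : iPow (a + b) = iPow a * iPow b := by
  unfold iPow
  rw [ZMod.val_add, ← Complex.I_pow_eq_pow_mod, pow_add]

lemma iPow_conj (c : ZMod 4) : iPow c * (starRingEnd ℂ) (iPow c) = 1 := by
  unfold iPow
  rw [map_pow, ← mul_pow, Complex.conj_I]
  simp

lemma iPow_star (c : ZMod 4) : (starRingEnd ℂ) (iPow c) = iPow (-c) := by
  have h1 := iPow_conj c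
  have h2 : iPow c * iPow (-c) = 1 := by
    rw [← iPow_add, add_neg_cancel]
    simp [iPow]
  have h3 : iPow c ≠ 0 := by
    intro h
    rw [h, zero_mul] at h2
    exact zero_ne_one h2
  exact mul_left_cancel₀ h3 (h1.trans h2.symm)

lemma iPow_exp (m : ℤ) : Complex.exp (Real.pi / 2 * Complex.I * m) = iPow (m : ZMod 4) := by
  unfold iPow
  have h1 : ((m : ZMod 4).val : ℤ) = m % 4 := ZMod.val_intCast m
  have h2 : m = 4 * (m / 4) + ((m : ZMod 4).val : ℤ) := by rw [h1]; omega
  have h3 : (m : ℂ) = 4 * ((m / 4 : ℤ) : ℂ) + ((m : ZMod 4).val : ℂ) := by exact_mod_cast h2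
  have h4 : (Real.pi / 2 * Complex.I * m : ℂ) = ((m / 4 : ℤ) : ℂ) * (2 * Real.pi * Complex.I) +
      ((m : ZMod 4).val : ℂ) * (Real.pi / 2 * Complex.I) := by
    rw [h3]; ring
  rw [h4, Complex.exp_add, Complex.exp_int_mul_two_pi_mul_I, one_mul, Complex.exp_nat_mul,
    Complex.exp_pi_div_two_mul_I]

end ThetaAux7

/-- Let `θ` be a theta function for `q`.  Then for all `z ∈ ℂ^g` one has
`θ(i·z) = (1 − i)^{−g} · (∑_{α ∈ A_i} i^{Q_q(α)}) · θ(z)`. -/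
theorem statement0 (g : ℕ) (hg : 1 ≤ g)
    (Γ : AddSubgroup (Fin g → ℂ))
    [Module.Free ℤ ↥Γ] [Module.Finite ℤ ↥Γ]
    (hrank : Module.finrank ℤ ↥Γ = 2 * g)
    (hspan : Submodule.span ℝ (Γ : Set (Fin g → ℂ)) = ⊤)
    -- multiplication by `i` preserves `Γ`
    (Imul : ↥Γ →+ ↥Γ)
    (hImul : ∀ x : ↥Γ, (Imul x : Fin g → ℂ) = Complex.I • (x : Fin g → ℂ))
    -- `H` takes values in `ℤ[i]` on `Γ × Γ`
    (hHint : ∀ x y : ↥Γ, ∃ a b : ℤ, Hform g x y = (a : ℂ) + (b : ℂ) * Complex.I)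
    -- `E := Im H` is a unimodular pairing on `Γ`
    (hunimod : ∀ φ : ↥Γ →ₗ[ℤ] ℤ, ∃! x : ↥Γ, ∀ y : ↥Γ, (Hform g x y).im = (φ y : ℝ))
    -- `A₂ := Γ/2Γ`
    (A₂ : Type) [AddCommGroup A₂] [Module (ZMod 2) A₂] [Finite A₂]
    (pr : ↥Γ →+ A₂) (hpr : Function.Surjective pr)
    (hker : ∀ x : ↥Γ, pr x = 0 ↔ ∃ y : ↥Γ, x = 2 • y)
    -- the involution `ī` induced by `i`
    (Ibar : A₂ →ₗ[ZMod 2] A₂) (hIbar : ∀ x : ↥Γ, Ibar (pr x) = pr (Imul x))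
    -- the symplectic form `e` induced by `E`
    (e : A₂ →ₗ[ZMod 2] A₂ →ₗ[ZMod 2] ZMod 2)
    (he : ∀ x y : ↥Γ, ∀ n : ℤ, (Hform g x y).im = (n : ℝ) → e (pr x) (pr y) = (n : ZMod 2))
    -- the quadratic form `Q` induced by `x ↦ S(x, x) mod 4`
    (Q : A₂ → ZMod 4)
    (hQ : ∀ x : ↥Γ, ∀ n : ℤ, (Hform g x x).re = (n : ℝ) → Q (pr x) = (n : ZMod 4))
    -- an `ī`-invariant quadratic form `q` associated to `e`
    (q : A₂ → ZMod 4)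
    (hq : ∀ x y : A₂, q (x + y) = q x + q y + emb2 (e x y))
    (hqi : ∀ x : A₂, q (Ibar x) = q x)
    -- `Q_q`, determined on `A_i = ε(A₂)` by `Q_q(εα) = q(α) − Q(α)`
    (Qq : A₂ → ZMod 4)
    (hQq : ∀ α : A₂, Qq (α + Ibar α) = q α - Q α)
    -- `θ` is a theta function for `q`
    (θ : (Fin g → ℂ) → ℂ)
    (hθd : Differentiable ℂ θ)
    (hθne : θ ≠ 0)
    (hθfe : ∀ (γ : ↥Γ) (z : Fin g → ℂ), θ (z + (γ : Fin g → ℂ)) =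
      iPow (q (pr γ)) *
          Complex.exp ((Real.pi : ℂ) *
            Hform g (γ : Fin g → ℂ) (z + (2 : ℂ)⁻¹ • (γ : Fin g → ℂ))) *
        θ z) :
    ∀ z : Fin g → ℂ, θ (Complex.I • z) =
      (1 - Complex.I) ^ (-(g : ℤ)) * (∑ᶠ α : ↥(Asub Ibar), iPow (Qq (α : A₂))) * θ z := by
  classical
  obtain ⟨b, hvol, hΓ, ν, hν⟩ := setup_lattice Γ hrank hspan hHint hunimod
  have : Countable Γ := ν.countable_iff.2 inferInstance
  have hF := fd_of b hΓ
  let χ : Γ → ℂ := fun γ => iPow (q (pr γ))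
  have hχ : ∀ γ, χ γ * (starRingEnd ℂ) (χ γ) = 1 := fun γ => iPow_conj _
  have hθ : IsTh Γ χ θ := ⟨hθd, hθfe⟩
  have hf : IsTh Γ χ (fun z => θ (Complex.I • z)) := by
    refine ⟨hθd.comp (differentiable_id.const_smul Complex.I), fun γ z => ?_⟩
    have h := hθfe (Imul γ) (Complex.I • z)
    rw [← hIbar, hqi, hImul, ← smul_add] at h
    simp only
    rw [h]
    congr 3
    have e2 : Complex.I • z + (2 : ℂ)⁻¹ • Complex.I • (γ : Fin g → ℂ) =
        Complex.I • (z + (2 : ℂ)⁻¹ • (γ : Fin g → ℂ)) := by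
      rw [smul_add, smul_comm]
    rw [e2, Hf_smul_left, Hf_smul_right, Complex.conj_I]
    linear_combination (-(Real.pi : ℂ) *
      Hform g γ (z + (2 : ℂ)⁻¹ • (γ : Fin g → ℂ))) * Complex.I_mul_I
  have hexx : ∀ γ : Γ, e (pr γ) (pr γ) = 0 := by
    intro γ
    have := he γ γ 0 (by rw [Hf_self]; simp only [Complex.ofReal_im]; simp)
    simpa using this
  have hxx : ∀ x : A₂, x + x = 0 := by
    intro x
    rw [← two_smul (ZMod 2) x]
    have : (2 : ZMod 2) = 0 := rfl
    rw [this, zero_smul]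
  have hq0 : q 0 = 0 := by
    have := hq 0 0
    simp only [add_zero, map_zero] at this
    have h2 : emb2 0 = 0 := rfl
    rw [h2, add_zero] at this
    exact left_eq_add.1 this
  have hqq : ∀ γ : Γ, -q (pr γ) = q (pr γ) := by
    intro γ
    have := hq (pr γ) (pr γ)
    rw [hexx, hxx, hq0] at this
    have h2 : emb2 0 = 0 := rfl
    rw [h2, add_zero] at this
    exact neg_eq_of_add_eq_zero_left this.symm
  have hψ0 : ∀ γ : Γ, (starRingEnd ℂ) (χ γ) *
      Complex.exp (-(Real.pi / 2 * Complex.I) * Hform g γ γ) =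
      iPow (Qq (pr γ + Ibar (pr γ))) := by
    intro γ
    obtain ⟨a, c, hac⟩ := hHint γ γ
    have hc : (c : ℝ) = 0 := by
      have := congrArg Complex.im hac
      rw [Hf_self] at this
      simp only [Complex.ofReal_im] at this
      simpa using this.symm
    have hc' : c = 0 := by exact_mod_cast hc
    have hH : Hform g γ γ = (a : ℂ) := by rw [hac, hc']; simp
    have hQ1 : Q (pr γ) = (a : ZMod 4) := hQ γ a (by rw [hH]; simp)
    have h1 : Complex.exp (-(Real.pi / 2 * Complex.I) * Hform g γ γ) =
        iPow ((-a : ℤ) : ZMod 4) := by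
      rw [← iPow_exp, hH]
      congr 1
      push_cast
      ring
    rw [h1, iPow_star, hqq, ← iPow_add, hQq, hQ1]
    congr 1
    push_cast
    ring
  -- the bijection
  have hII : ∀ γ : Γ, Imul (Imul γ) = -γ := by
    intro γ
    apply Subtype.ext
    rw [hImul, hImul, smul_smul, Complex.I_mul_I]
    simp
  have hε : ∀ δ : Γ, pr (δ - Imul δ) + Ibar (pr (δ - Imul δ)) = 0 := by
    intro δ
    rw [hIbar, ← map_add, hker]
    refine ⟨δ, ?_⟩
    rw [map_sub, hII]
    abel
  have hs : ∀ α : Asub Ibar, ∃ γ : Γ, pr γ + Ibar (pr γ) = α := by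
    rintro ⟨α, y, rfl⟩
    obtain ⟨γ, rfl⟩ := hpr y
    exact ⟨γ, rfl⟩
  choose s hs using hs
  have hsT : ∀ (α : Asub Ibar) (δ : Γ),
      pr (s α + (δ - Imul δ)) + Ibar (pr (s α + (δ - Imul δ))) = α := by
    intro α δ
    rw [map_add, map_add, add_add_add_comm, hε, hs, add_zero]
  have hcI : (1 + Complex.I) / 2 * (1 - Complex.I) = 1 := by
    linear_combination (-1 / 2 : ℂ) * Complex.I_mul_I
  have hpc : ∀ δ : Γ, ((1 + Complex.I) / 2) • ((δ - Imul δ : Γ) : Fin g → ℂ) = δ := by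
    intro δ
    have : ((δ - Imul δ : Γ) : Fin g → ℂ) = (1 - Complex.I) • (δ : Fin g → ℂ) := by
      rw [AddSubgroup.coe_sub, hImul, sub_smul, one_smul]
    rw [this, smul_smul, hcI, one_smul]
  have hbij : Function.Bijective (fun x : Asub Ibar × Γ => s x.1 + (x.2 - Imul x.2)) := by
    constructor
    · rintro ⟨α, δ⟩ ⟨α', δ'⟩ h
      simp only at h
      have h1 : α = α' := by
        apply Subtype.ext
        rw [← hsT α δ, ← hsT α' δ', h]
      subst h1
      have h2 := add_left_cancel h
      have h3 : δ = δ' := by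
        apply Subtype.ext
        rw [← hpc δ, ← hpc δ', h2]
      rw [h3]
    · intro γ
      let α : Asub Ibar := ⟨pr γ + Ibar (pr γ), ⟨pr γ, rfl⟩⟩
      have h1 : pr ((γ - s α) + Imul (γ - s α)) = 0 := by
        rw [map_add, ← hIbar, map_sub, map_sub, sub_add_sub_comm, hs]
        exact sub_self _
      obtain ⟨y, hy⟩ := (hker _).1 h1
      refine ⟨(α, y), ?_⟩
      have h2 : y - Imul y = γ - s α := by
        have h3 : (2 : ℕ) • (y - Imul y) = (2 : ℕ) • (γ - s α) := by
          rw [nsmul_sub, ← map_nsmul, ← hy, map_add, hII]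
          abel
        apply Subtype.ext
        have h4 := congrArg (Subtype.val) h3
        simp only [AddSubgroup.coe_nsmul] at h4
        ext j
        have h5 := congrFun h4 j
        simpa using h5
      simp only [h2]
      abel
  let T : Asub Ibar × Γ ≃ Γ := Equiv.ofBijective _ hbij
  have hT : ∀ α δ, T (α, δ) = s α + (δ - Imul δ) := fun _ _ => rfl
  have : Fintype (Asub Ibar) := Fintype.ofFinite _
  let F := ZSpan.fundamentalDomain b
  have key := trace_int hF T (fun γ => ((1 + Complex.I) / 2) • (γ : Fin g → ℂ))
    (fun α => ((1 + Complex.I) / 2) • (s α : Fin g → ℂ))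
    (by
      intro α δ
      simp only [hT]
      rw [AddSubgroup.coe_add, smul_add, hpc])
    (fun γ => iPow (Qq (pr γ + Ibar (pr γ)))) (fun α => iPow (Qq (α : A₂)))
    (by intro α δ; simp only [hT, hsT])
    (Aint F θ θ 0) (Phi (fun z => θ (Complex.I • z)) θ 0)
    (by
      intro z
      have h := (theta_expand b hvol hΓ ν hν hχ hθ hθ ((Complex.I - 1) • z) z).mul_right
        (Complex.exp (-(Real.pi : ℂ) * (1 - Complex.I) * Hform g z z))
      refine Eq.mp (congrArg₂ HasSum (funext fun γ => ?_) ?_ ) h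
      · symm
        rw [← hψ0]
        have e1 : 2 * (Real.pi : ℂ) * Complex.I * ((Hform g γ z).im : ℂ) =
            (Real.pi : ℂ) * (Hform g γ z - Hform g z γ) := by rw [Hf_swap]; ring
        have e2 : Complex.exp (-(Real.pi / 2 * Complex.I) * Hform g γ γ) *
            kg (z - ((1 + Complex.I) / 2) • (γ : Fin g → ℂ)) =
            Complex.exp (-(Real.pi : ℂ) / 2 * Hform g γ γ -
              Real.pi * Hform g γ ((Complex.I - 1) • z)) *
            Complex.exp (-((Real.pi : ℂ) * (Hform g γ z - Hform g z γ))) *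
            Complex.exp (-(Real.pi : ℂ) * (1 - Complex.I) * Hform g z z) := by
          unfold kg
          simp only [← Complex.exp_add]
          congr 1
          simp only [Hf_sub_left, Hf_sub_right, Hf_smul_left, Hf_smul_right, map_div₀, map_add,
            map_one, Complex.conj_I, map_ofNat]
          have hI3 : Complex.I ^ 2 = -1 := Complex.I_sq
          generalize Complex.I = i at *
          generalize (Real.pi : ℂ) = P at *
          generalize Hform g z z = Z at *
          generalize Hform g γ γ = N at *
          generalize Hform g γ z = u at *
          generalize Hform g z γ = w at *
          linear_combination (-P * w / 2 + P * u / 2 + P * (1 - i) / 4 * N) * hI3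
        rw [e1]
        linear_combination (Aint F θ θ 0 * (starRingEnd ℂ) (χ γ)) * e2
      · symm
        unfold Phi
        have e3 : z + (Complex.I - 1) • z = Complex.I • z := by
          rw [sub_smul, one_smul]; abel
        rw [e3, add_zero, mul_assoc _ (Complex.exp _) (Complex.exp _), ← Complex.exp_add]
        congr 2
        rw [Hf_smul_right]
        have : Hform g z 0 = 0 := by simp [Hform]
        rw [this]
        ring)
  intro z
  have hfin := theta_prop b hvol hΓ ν hν hχ hf hθ hθne
    ((1 - Complex.I) ^ (-(g : ℤ)) * (∑ᶠ α : ↥(Asub Ibar), iPow (Qq (α : A₂)))) (by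
      rw [finsum_eq_sum_of_fintype]
      refine key.trans ?_
      ring)
  exact hfin z
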